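/- arXiv:1403.1666 — 12 statements merged into one kernel-verified Lean document; each statement's English description precedes it below -/
import Mathlib

section
/- Let η = ω0 be a finite trace of length 1 and φ an LTLf formula. Then η ⊨ φ iff there exists a clause α ∧ X(ψ) ∈ NF(φ) such that ω0 ⊨ α and the length-1 trace CF(α) satisfies φ. -/
namespace LTLfPaper

/-- Literals over atomic propositions: `p` or `¬p`. -/
inductive Lit (P : Type) : Type
  | pos (p : P)
  | neg (p : P)

/-- A state is a set of literals; `Σ = 2^L`. -/
abbrev State (P : Type) := Set (Lit P)

/-- LTLf formulas in negation normal form. -/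
inductive LTLf (P : Type) : Type
  | tt
  | ff
  | pos (p : P)
  | neg (p : P)
  | and (φ ψ : LTLf P)
  | or (φ ψ : LTLf P)
  | next (φ : LTLf P)
  | wnext (φ : LTLf P)
  | untl (φ ψ : LTLf P)
  | rel (φ ψ : LTLf P)

/-- Finite-trace (LTLf) satisfaction: traces are (intended nonempty) lists of states;
the suffix `η_i` is `η.drop i`, and the first state `ω0` is `η.getD 0 ∅`. -/
def Sat {P : Type} : LTLf P → List (State P) → Prop
  | .tt, _ => True
  | .ff, _ => False
  | .pos p, η => Lit.pos p ∈ η.getD 0 ∅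
  | .neg p, η => Lit.neg p ∈ η.getD 0 ∅
  | .and φ ψ, η => Sat φ η ∧ Sat ψ η
  | .or φ ψ, η => Sat φ η ∨ Sat ψ η
  | .next φ, η => 1 < η.length ∧ Sat φ η.tail
  | .wnext φ, η => η.length = 1 ∨ (1 < η.length ∧ Sat φ η.tail)
  | .untl φ ψ, η => ∃ i < η.length, Sat ψ (η.drop i) ∧ ∀ j < i, Sat φ (η.drop j)
  | .rel φ ψ, η => (∀ i < η.length, Sat ψ (η.drop i)) ∨
      ∃ i < η.length, Sat φ (η.drop i) ∧ ∀ j ≤ i, Sat ψ (η.drop j)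

/-- Infinite-trace (standard LTL) satisfaction, for reading (Xw-free) formulas as LTL.
(The `wnext` clause coincides with `next`; it is irrelevant for Xw-free formulas.) -/
def SatInf {P : Type} : LTLf P → (ℕ → State P) → Prop
  | .tt, _ => True
  | .ff, _ => False
  | .pos p, ξ => Lit.pos p ∈ ξ 0
  | .neg p, ξ => Lit.neg p ∈ ξ 0
  | .and φ ψ, ξ => SatInf φ ξ ∧ SatInf ψ ξ
  | .or φ ψ, ξ => SatInf φ ξ ∨ SatInf ψ ξ
  | .next φ, ξ => SatInf φ (fun n => ξ (n + 1))
  | .wnext φ, ξ => SatInf φ (fun n => ξ (n + 1))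
  | .untl φ ψ, ξ => ∃ i, SatInf ψ (fun n => ξ (n + i)) ∧ ∀ j < i, SatInf φ (fun n => ξ (n + j))
  | .rel φ ψ, ξ => (∀ i, SatInf ψ (fun n => ξ (n + i))) ∨
      ∃ i, SatInf φ (fun n => ξ (n + i)) ∧ ∀ j ≤ i, SatInf ψ (fun n => ξ (n + j))

/-- A formula is Xw-free iff it contains no `Xw` operator. -/
def XwFree {P : Type} : LTLf P → Prop
  | .wnext _ => False
  | .and φ ψ | .or φ ψ | .untl φ ψ | .rel φ ψ => XwFree φ ∧ XwFree ψ
  | .next φ => XwFree φ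
  | _ => True

/-- Propositional satisfaction `ω ⊨ α` (only meaningful for propositional formulas). -/
def PSat {P : Type} (ω : State P) : LTLf P → Prop
  | .tt => True
  | .ff => False
  | .pos p => Lit.pos p ∈ ω
  | .neg p => Lit.neg p ∈ ω
  | .and α β => PSat ω α ∧ PSat ω β
  | .or α β => PSat ω α ∨ PSat ω β
  | _ => False

/-- `DF φ`: the set of disjuncts of `φ`. -/
def DF {P : Type} : LTLf P → Set (LTLf P)
  | .or φ ψ => DF φ ∪ DF ψ
  | φ => {φ}

/-- `CF φ`: the set of conjuncts of `φ`. -/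
def CF {P : Type} : LTLf P → Set (LTLf P)
  | .and φ ψ => CF φ ∪ CF ψ
  | φ => {φ}

/-- `CF(α)` viewed as a single state: the set of literals occurring as conjuncts of `α`. -/
def litsOf {P : Type} : LTLf P → State P
  | .and α β => litsOf α ∪ litsOf β
  | .pos p => {Lit.pos p}
  | .neg p => {Lit.neg p}
  | _ => ∅

/-- `NFmem φ α ψ` means the clause `α ∧ X(ψ)` belongs to the normal form `NF(φ)`. -/
inductive NFmem {P : Type} : LTLf P → LTLf P → LTLf P → Prop
  | tt : NFmem .tt .tt .tt
  | pos (p : P) : NFmem (.pos p) (.pos p) .tt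
  | neg (p : P) : NFmem (.neg p) (.neg p) .tt
  | next {φ ψ : LTLf P} : ψ ∈ DF φ → NFmem (.next φ) .tt ψ
  | wnext {φ ψ : LTLf P} : ψ ∈ DF φ → NFmem (.wnext φ) .tt ψ
  | untl₁ {φ₁ φ₂ α ψ : LTLf P} : NFmem φ₂ α ψ → NFmem (.untl φ₁ φ₂) α ψ
  | untl₂ {φ₁ φ₂ α ψ : LTLf P} :
      NFmem (.and φ₁ (.next (.untl φ₁ φ₂))) α ψ → NFmem (.untl φ₁ φ₂) α ψ
  | rel₁ {φ₁ φ₂ α ψ : LTLf P} : NFmem (.and φ₁ φ₂) α ψ → NFmem (.rel φ₁ φ₂) α ψ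
  | rel₂ {φ₁ φ₂ α ψ : LTLf P} :
      NFmem (.and φ₂ (.next (.rel φ₁ φ₂))) α ψ → NFmem (.rel φ₁ φ₂) α ψ
  | or₁ {φ₁ φ₂ α ψ : LTLf P} : NFmem φ₁ α ψ → NFmem (.or φ₁ φ₂) α ψ
  | or₂ {φ₁ φ₂ α ψ : LTLf P} : NFmem φ₂ α ψ → NFmem (.or φ₁ φ₂) α ψ
  | and' {φ₁ φ₂ α₁ ψ₁ α₂ ψ₂ : LTLf P} : NFmem φ₁ α₁ ψ₁ → NFmem φ₂ α₂ ψ₂ →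
      NFmem (.and φ₁ φ₂) (.and α₁ α₂) (.and ψ₁ ψ₂)

/-- One transition step of the transition system `T_φ`. -/
def Step {P : Type} (ψ₁ ψ₂ : LTLf P) : Prop := ∃ α, NFmem ψ₁ α ψ₂

/-- Reachability in the transition system by a finite sequence of transitions. -/
def Reachable {P : Type} (φ ψ : LTLf P) : Prop := Relation.ReflTransGen Step φ ψ

/-- A state `ψ₁` is accepting iff some transition `ψ₁ →α ψ₂` satisfies `CF(α) ⊨ ψ₁`. -/
def Accepting {P : Type} (ψ₁ : LTLf P) : Prop :=
  ∃ α ψ₂, NFmem ψ₁ α ψ₂ ∧ Sat ψ₁ [litsOf α]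

/-- The release obligation formula `ofr`. -/
def ofr {P : Type} : LTLf P → LTLf P
  | .tt => .tt
  | .ff => .ff
  | .pos p => .pos p
  | .neg p => .neg p
  | .and φ ψ => .and (ofr φ) (ofr ψ)
  | .or φ ψ => .or (ofr φ) (ofr ψ)
  | .next _ => .ff
  | .wnext _ => .ff
  | .untl _ ψ => ofr ψ
  | .rel _ ψ => ofr ψ

/-- The global obligation formula `ofg`. -/
def ofg {P : Type} : LTLf P → LTLf P
  | .tt => .tt
  | .ff => .ff
  | .pos p => .pos p
  | .neg p => .neg p
  | .and φ ψ => .and (ofg φ) (ofg ψ)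
  | .or φ ψ => .or (ofg φ) (ofg ψ)
  | .next _ => .ff
  | .wnext _ => .tt
  | .untl _ ψ => ofg ψ
  | .rel _ ψ => ofg ψ

/-- The general obligation formula `off`. -/
def off {P : Type} : LTLf P → LTLf P
  | .tt => .tt
  | .ff => .ff
  | .pos p => .pos p
  | .neg p => .neg p
  | .and φ ψ => .and (off φ) (off ψ)
  | .or φ ψ => .or (off φ) (off ψ)
  | .next φ => off φ
  | .wnext φ => off φ
  | .untl _ ψ => off ψ
  | .rel _ ψ => ofr ψ


theorem sat_untl_singleton {P : Type} (φ ψ : LTLf P) (ω : State P) :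
    Sat (.untl φ ψ) [ω] ↔ Sat ψ [ω] := by
  simp [Sat]

theorem sat_rel_singleton {P : Type} (φ ψ : LTLf P) (ω : State P) :
    Sat (.rel φ ψ) [ω] ↔ Sat ψ [ω] := by
  simp [Sat]

theorem Sat.singleton_mono {P : Type} {ω ω' : State P} (hω : ω ⊆ ω') {φ : LTLf P}
    (h : Sat φ [ω]) : Sat φ [ω'] := by
  induction φ with
  | tt => trivial
  | ff => exact h
  | pos p => exact hω h
  | neg p => exact hω h
  | and φ ψ ihφ ihψ => exact ⟨ihφ h.1, ihψ h.2⟩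
  | or φ ψ ihφ ihψ => exact h.imp ihφ ihψ
  | next φ _ => exact absurd h.1 (lt_irrefl 1)
  | wnext φ _ => exact Or.inl rfl
  | untl φ ψ _ ihψ =>
    rw [sat_untl_singleton] at h ⊢
    exact ihψ h
  | rel φ ψ _ ihψ =>
    rw [sat_rel_singleton] at h ⊢
    exact ihψ h

theorem PSat.litsOf_subset {P : Type} {ω : State P} {α : LTLf P} (h : PSat ω α) :
    litsOf α ⊆ ω := by
  induction α with
  | and α β ihα ihβ => exact Set.union_subset (ihα h.1) (ihβ h.2)
  | pos p => exact Set.singleton_subset_iff.2 h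
  | neg p => exact Set.singleton_subset_iff.2 h
  | _ => exact Set.empty_subset ω

theorem DF_nonempty {P : Type} (φ : LTLf P) : (DF φ).Nonempty := by
  induction φ with
  | or φ ψ ihφ _ => exact ihφ.inl
  | _ => exact Set.singleton_nonempty _

theorem exists_NFmem_of_sat_singleton {P : Type} {φ : LTLf P} {ω : State P} (h : Sat φ [ω]) :
    ∃ α ψ, NFmem φ α ψ ∧ PSat ω α ∧ Sat φ [litsOf α] := by
  induction φ with
  | tt => exact ⟨_, _, .tt, trivial, trivial⟩
  | ff => exact h.elim
  | pos p => exact ⟨_, _, .pos p, h, rfl⟩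
  | neg p => exact ⟨_, _, .neg p, h, rfl⟩
  | and φ₁ φ₂ ih₁ ih₂ =>
    obtain ⟨α₁, ψ₁, hm₁, hp₁, hs₁⟩ := ih₁ h.1
    obtain ⟨α₂, ψ₂, hm₂, hp₂, hs₂⟩ := ih₂ h.2
    exact ⟨_, _, .and' hm₁ hm₂, ⟨hp₁, hp₂⟩,
      hs₁.singleton_mono Set.subset_union_left, hs₂.singleton_mono Set.subset_union_right⟩
  | or φ₁ φ₂ ih₁ ih₂ =>
    rcases h with h | h
    · obtain ⟨α, ψ, hm, hp, hs⟩ := ih₁ h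
      exact ⟨α, ψ, .or₁ hm, hp, Or.inl hs⟩
    · obtain ⟨α, ψ, hm, hp, hs⟩ := ih₂ h
      exact ⟨α, ψ, .or₂ hm, hp, Or.inr hs⟩
  | next φ _ => exact absurd h.1 (lt_irrefl 1)
  | wnext φ _ =>
    obtain ⟨ψ, hψ⟩ := DF_nonempty φ
    exact ⟨_, ψ, .wnext hψ, trivial, Or.inl rfl⟩
  | untl φ₁ φ₂ _ ih₂ =>
    obtain ⟨α, ψ, hm, hp, hs⟩ := ih₂ ((sat_untl_singleton _ _ _).1 h)
    exact ⟨α, ψ, .untl₁ hm, hp, (sat_untl_singleton _ _ _).2 hs⟩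
  | rel φ₁ φ₂ _ ih₂ =>
    obtain ⟨α, ψ, hm, hp, hs⟩ := ih₂ ((sat_rel_singleton _ _ _).1 h)
    exact ⟨_, _, .rel₂ (.and' hm (.next (Set.mem_singleton _))), ⟨hp, trivial⟩,
      (sat_rel_singleton _ _ _).2 (hs.singleton_mono Set.subset_union_left)⟩

/-- For a length-1 trace `η = ω₀`: `η ⊨ φ` iff there is a clause
`α ∧ X(ψ) ∈ NF(φ)` with `ω₀ ⊨ α` and the length-1 trace `CF(α)` satisfies `φ`. -/
theorem stmt1 {P : Type} (φ : LTLf P) (ω₀ : State P) :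
    Sat φ [ω₀] ↔ ∃ α ψ, NFmem φ α ψ ∧ PSat ω₀ α ∧ Sat φ [litsOf α] := by
  refine ⟨exists_NFmem_of_sat_singleton, ?_⟩
  rintro ⟨α, ψ, -, hp, hs⟩
  exact hs.singleton_mono hp.litsOf_subset

end LTLfPaper
end

section
/- Let η = ω0ω1…ωn be a finite trace with n ≥ 1 and φ an LTLf formula. Then η ⊨ φ iff there exists a clause α ∧ X(ψ) ∈ NF(φ) such that ω0 ⊨ α and η_1 ⊨ ψ. -/
namespace LTLfPaper

theorem exists_mem_DF_sat_iff {P : Type} (φ : LTLf P) (η : List (State P)) :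
    (∃ ψ ∈ DF φ, Sat ψ η) ↔ Sat φ η := by
  induction φ with
  | or φ ψ ihφ ihψ =>
    simp only [DF, Sat, Set.mem_union, or_and_right, exists_or]
    exact or_congr ihφ ihψ
  | _ => simp [DF]

theorem sat_untl_iff {P : Type} (φ ψ : LTLf P) {η : List (State P)} (hη : 1 < η.length) :
    Sat (.untl φ ψ) η ↔ Sat ψ η ∨ Sat φ η ∧ Sat (.untl φ ψ) η.tail := by
  simp only [Sat, List.length_tail, List.drop_tail]
  constructor
  · rintro ⟨_ | i, hi, h, hj⟩
    · exact Or.inl h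
    · exact Or.inr ⟨hj 0 (by omega), i, by omega, h, fun j hji => hj (j + 1) (by omega)⟩
  · rintro (h | ⟨h, i, hi, hψ, hj⟩)
    · exact ⟨0, by omega, h, by simp⟩
    · refine ⟨i + 1, by omega, hψ, ?_⟩
      rintro (_ | j) hji
      · exact h
      · exact hj j (by omega)

theorem sat_rel_iff {P : Type} (φ ψ : LTLf P) {η : List (State P)} (hη : 1 < η.length) :
    Sat (.rel φ ψ) η ↔ Sat φ η ∧ Sat ψ η ∨ Sat ψ η ∧ Sat (.rel φ ψ) η.tail := by
  simp only [Sat, List.length_tail, List.drop_tail]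
  constructor
  · rintro (h | ⟨_ | i, hi, h, hj⟩)
    · exact Or.inr ⟨h 0 (by omega), Or.inl fun i hi => h (i + 1) (by omega)⟩
    · exact Or.inl ⟨h, hj 0 le_rfl⟩
    · exact Or.inr ⟨hj 0 (by omega),
        Or.inr ⟨i, by omega, h, fun j hji => hj (j + 1) (by omega)⟩⟩
  · rintro (⟨hφ, hψ⟩ | ⟨h, hs | ⟨i, hi, hφ, hj⟩⟩)
    · refine Or.inr ⟨0, by omega, hφ, fun j hj => ?_⟩
      obtain rfl : j = 0 := by omega
      exact hψ
    · refine Or.inl ?_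
      rintro (_ | i) hi
      · exact h
      · exact hs i (by omega)
    · refine Or.inr ⟨i + 1, by omega, hφ, ?_⟩
      rintro (_ | j) hji
      · exact h
      · exact hj j (by omega)

theorem NFmem.sat {P : Type} {φ α ψ : LTLf P} (h : NFmem φ α ψ) {η : List (State P)}
    (hη : 1 < η.length) (hα : PSat (η.getD 0 ∅) α) (hψ : Sat ψ η.tail) : Sat φ η := by
  induction h with
  | tt => trivial
  | pos p => exact hα
  | neg p => exact hα
  | next hD => exact ⟨hη, (exists_mem_DF_sat_iff _ _).1 ⟨_, hD, hψ⟩⟩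
  | wnext hD => exact Or.inr ⟨hη, (exists_mem_DF_sat_iff _ _).1 ⟨_, hD, hψ⟩⟩
  | untl₁ _ ih => exact (sat_untl_iff _ _ hη).2 (Or.inl (ih hα hψ))
  | untl₂ _ ih =>
    obtain ⟨h₁, _, h₂⟩ := ih hα hψ
    exact (sat_untl_iff _ _ hη).2 (Or.inr ⟨h₁, h₂⟩)
  | rel₁ _ ih => exact (sat_rel_iff _ _ hη).2 (Or.inl (ih hα hψ))
  | rel₂ _ ih =>
    obtain ⟨h₁, _, h₂⟩ := ih hα hψ
    exact (sat_rel_iff _ _ hη).2 (Or.inr ⟨h₁, h₂⟩)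
  | or₁ _ ih => exact Or.inl (ih hα hψ)
  | or₂ _ ih => exact Or.inr (ih hα hψ)
  | and' _ _ ih₁ ih₂ => exact ⟨ih₁ hα.1 hψ.1, ih₂ hα.2 hψ.2⟩

theorem exists_NFmem_of_sat {P : Type} (φ : LTLf P) {η : List (State P)} (hη : 1 < η.length)
    (h : Sat φ η) : ∃ α ψ, NFmem φ α ψ ∧ PSat (η.getD 0 ∅) α ∧ Sat ψ η.tail := by
  induction φ with
  | tt => exact ⟨_, _, .tt, trivial, trivial⟩
  | ff => exact h.elim
  | pos p => exact ⟨_, _, .pos p, h, trivial⟩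
  | neg p => exact ⟨_, _, .neg p, h, trivial⟩
  | and φ₁ φ₂ ih₁ ih₂ =>
    obtain ⟨α₁, ψ₁, n₁, a₁, s₁⟩ := ih₁ h.1
    obtain ⟨α₂, ψ₂, n₂, a₂, s₂⟩ := ih₂ h.2
    exact ⟨_, _, .and' n₁ n₂, ⟨a₁, a₂⟩, s₁, s₂⟩
  | or φ₁ φ₂ ih₁ ih₂ =>
    rcases h with h | h
    · obtain ⟨α, ψ, n, hs⟩ := ih₁ h
      exact ⟨_, _, .or₁ n, hs⟩
    · obtain ⟨α, ψ, n, hs⟩ := ih₂ h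
      exact ⟨_, _, .or₂ n, hs⟩
  | next φ =>
    obtain ⟨ψ, hD, hs⟩ := (exists_mem_DF_sat_iff _ _).2 h.2
    exact ⟨_, _, .next hD, trivial, hs⟩
  | wnext φ =>
    obtain ⟨ψ, hD, hs⟩ := (exists_mem_DF_sat_iff _ _).2 (h.resolve_left hη.ne').2
    exact ⟨_, _, .wnext hD, trivial, hs⟩
  | untl φ₁ φ₂ ih₁ ih₂ =>
    rcases (sat_untl_iff _ _ hη).1 h with h | ⟨h, ht⟩
    · obtain ⟨α, ψ, n, hs⟩ := ih₂ h
      exact ⟨_, _, .untl₁ n, hs⟩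
    · obtain ⟨α, ψ, n, a, s⟩ := ih₁ h
      exact ⟨_, _, .untl₂ (.and' n (.next rfl)), ⟨a, trivial⟩, s, ht⟩
  | rel φ₁ φ₂ ih₁ ih₂ =>
    rcases (sat_rel_iff _ _ hη).1 h with ⟨h₁, h₂⟩ | ⟨h, ht⟩
    · obtain ⟨α₁, ψ₁, n₁, a₁, s₁⟩ := ih₁ h₁
      obtain ⟨α₂, ψ₂, n₂, a₂, s₂⟩ := ih₂ h₂
      exact ⟨_, _, .rel₁ (.and' n₁ n₂), ⟨a₁, a₂⟩, s₁, s₂⟩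
    · obtain ⟨α, ψ, n, a, s⟩ := ih₂ h
      exact ⟨_, _, .rel₂ (.and' n (.next rfl)), ⟨a, trivial⟩, s, ht⟩

/-- For a trace `η` of length at least 2 (`n ≥ 1`): `η ⊨ φ` iff there
is a clause `α ∧ X(ψ) ∈ NF(φ)` with `ω₀ ⊨ α` and `η_1 ⊨ ψ`. -/
theorem stmt2 {P : Type} (φ : LTLf P) (η : List (State P)) (hη : 1 < η.length) :
    Sat φ η ↔ ∃ α ψ, NFmem φ α ψ ∧ PSat (η.getD 0 ∅) α ∧ Sat ψ η.tail := by
  exact ⟨exists_NFmem_of_sat φ hη, fun ⟨_, _, h, hα, hψ⟩ => h.sat hη hα hψ⟩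

end LTLfPaper
end

section
/- Let η = ω0ω1…ωn be a finite trace and φ an LTLf formula. Then η ⊨ φ iff there exists a run φ = φ0 →α0 φ1 →α1 … →αn φ_{n+1} of T_φ on η such that for every 0 ≤ i ≤ n both ω_i ⊨ α_i and η_i ⊨ φ_i hold. -/
namespace LTLfPaper

theorem exists_mem_DF {P : Type} (φ : LTLf P) : ∃ ψ, ψ ∈ DF φ := by
  induction φ with
  | or φ₁ φ₂ ih₁ ih₂ => exact ih₁.imp fun _ h => Or.inl h
  | _ => exact ⟨_, rfl⟩

theorem exists_mem_DF_sat {P : Type} {φ : LTLf P} {η : List (State P)} (h : Sat φ η) :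
    ∃ ψ ∈ DF φ, Sat ψ η := by
  induction φ with
  | or φ₁ φ₂ ih₁ ih₂ =>
    rcases h with h | h
    · obtain ⟨ψ, hm, hs⟩ := ih₁ h
      exact ⟨ψ, Or.inl hm, hs⟩
    · obtain ⟨ψ, hm, hs⟩ := ih₂ h
      exact ⟨ψ, Or.inr hm, hs⟩
  | _ => exact ⟨_, rfl, h⟩

/-- A disjunct of `φ` that holds on `η` as soon as some condition forces `φ` to hold there. -/
theorem exists_mem_DF_of_imp {P : Type} {φ : LTLf P} {η : List (State P)} {C : Prop}
    (h : C → Sat φ η) : ∃ ψ ∈ DF φ, C → Sat ψ η := by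
  by_cases hC : C
  · obtain ⟨ψ, hm, hs⟩ := exists_mem_DF_sat (h hC)
    exact ⟨ψ, hm, fun _ => hs⟩
  · obtain ⟨ψ, hm⟩ := exists_mem_DF φ
    exact ⟨ψ, hm, fun hC' => absurd hC' hC⟩

theorem Sat.untl_tail {P : Type} {φ₁ φ₂ : LTLf P} {η : List (State P)} {i : ℕ}
    (hi : i + 1 < η.length) (h₂ : Sat φ₂ (η.drop (i + 1)))
    (h₁ : ∀ j < i + 1, Sat φ₁ (η.drop j)) : Sat (.untl φ₁ φ₂) η.tail := by
  refine ⟨i, by simp; omega, by simpa using h₂, fun j hj => ?_⟩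
  simpa using h₁ (j + 1) (by omega)

theorem Sat.rel_cases {P : Type} {φ₁ φ₂ : LTLf P} {η : List (State P)} (hη : η ≠ [])
    (h : Sat (.rel φ₁ φ₂) η) :
    Sat φ₂ η ∧ (Sat φ₁ η ∨ Sat (.rel φ₁ φ₂) η.tail) := by
  have hpos := List.length_pos_iff.mpr hη
  rcases h with h | ⟨i, hi, h₁, h₂⟩
  · refine ⟨by simpa using h 0 hpos, Or.inr (Or.inl fun i hi => ?_)⟩
    rw [List.length_tail] at hi
    simpa using h (i + 1) (by omega)
  · refine ⟨by simpa using h₂ 0 (Nat.zero_le _), ?_⟩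
    cases i with
    | zero => exact Or.inl (by simpa using h₁)
    | succ i =>
      refine Or.inr (Or.inr ⟨i, by simp; omega, by simpa using h₁, fun j hj => ?_⟩)
      simpa using h₂ (j + 1) (by omega)

/-- A formula that holds on a nonempty trace has a clause `α ∧ X(ψ)` in its normal form whose
propositional part holds in the first state and whose successor holds on the rest, if any. -/
theorem Sat.exists_NFmem {P : Type} {φ : LTLf P} {η : List (State P)} (hη : η ≠ [])
    (h : Sat φ η) :
    ∃ α ψ, NFmem φ α ψ ∧ PSat (η.getD 0 ∅) α ∧ (1 < η.length → Sat ψ η.tail) := by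
  induction φ with
  | tt => exact ⟨_, _, .tt, trivial, fun _ => trivial⟩
  | ff => exact h.elim
  | pos p => exact ⟨_, _, .pos p, h, fun _ => trivial⟩
  | neg p => exact ⟨_, _, .neg p, h, fun _ => trivial⟩
  | and φ₁ φ₂ ih₁ ih₂ =>
    obtain ⟨α₁, ψ₁, hn₁, hp₁, hs₁⟩ := ih₁ h.1
    obtain ⟨α₂, ψ₂, hn₂, hp₂, hs₂⟩ := ih₂ h.2
    exact ⟨_, _, .and' hn₁ hn₂, ⟨hp₁, hp₂⟩, fun hl => ⟨hs₁ hl, hs₂ hl⟩⟩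
  | or φ₁ φ₂ ih₁ ih₂ =>
    rcases h with h | h
    · obtain ⟨α, ψ, hn, hr⟩ := ih₁ h
      exact ⟨α, ψ, .or₁ hn, hr⟩
    · obtain ⟨α, ψ, hn, hr⟩ := ih₂ h
      exact ⟨α, ψ, .or₂ hn, hr⟩
  | next φ ih =>
    obtain ⟨ψ, hm, hs⟩ := exists_mem_DF_sat h.2
    exact ⟨_, ψ, .next hm, trivial, fun _ => hs⟩
  | wnext φ ih =>
    obtain ⟨ψ, hm, hs⟩ := exists_mem_DF_of_imp (φ := φ) (η := η.tail) (C := 1 < η.length)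
      fun hl => h.elim (fun h' => absurd h' hl.ne') And.right
    exact ⟨_, ψ, .wnext hm, trivial, hs⟩
  | untl φ₁ φ₂ ih₁ ih₂ =>
    obtain ⟨i, hi, h₂, h₁⟩ := h
    cases i with
    | zero =>
      obtain ⟨α, ψ, hn, hr⟩ := ih₂ (by simpa using h₂)
      exact ⟨α, ψ, .untl₁ hn, hr⟩
    | succ i =>
      obtain ⟨α, ψ, hn, hp, hs⟩ := ih₁ (by simpa using h₁ 0 (Nat.succ_pos i))
      exact ⟨_, _, .untl₂ (.and' hn (.next rfl)), ⟨hp, trivial⟩,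
        fun hl => ⟨hs hl, Sat.untl_tail hi h₂ h₁⟩⟩
  | rel φ₁ φ₂ ih₁ ih₂ =>
    obtain ⟨h₂, h₁ | ht⟩ := h.rel_cases hη
    · obtain ⟨α₁, ψ₁, hn₁, hp₁, hs₁⟩ := ih₁ h₁
      obtain ⟨α₂, ψ₂, hn₂, hp₂, hs₂⟩ := ih₂ h₂
      exact ⟨_, _, .rel₁ (.and' hn₁ hn₂), ⟨hp₁, hp₂⟩, fun hl => ⟨hs₁ hl, hs₂ hl⟩⟩
    · obtain ⟨α, ψ, hn, hp, hs⟩ := ih₂ h₂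
      exact ⟨_, _, .rel₂ (.and' hn (.next rfl)), ⟨hp, trivial⟩, fun hl => ⟨hs hl, ht⟩⟩

theorem Sat.exists_run {P : Type} {φ : LTLf P} {η : List (State P)} (h : Sat φ η) :
    ∃ (φs αs : ℕ → LTLf P), φs 0 = φ ∧
      ∀ i < η.length, NFmem (φs i) (αs i) (φs (i + 1)) ∧
        PSat (η.getD i ∅) (αs i) ∧ Sat (φs i) (η.drop i) := by
  induction η generalizing φ with
  | nil => exact ⟨fun _ => φ, fun _ => φ, rfl, by simp⟩
  | cons ω η ih =>
    obtain ⟨α, ψ, hn, hp, hs⟩ := h.exists_NFmem (List.cons_ne_nil ω η)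
    obtain ⟨φs, αs, h₀, hr⟩ : ∃ (φs αs : ℕ → LTLf P), φs 0 = ψ ∧
        ∀ i < η.length, NFmem (φs i) (αs i) (φs (i + 1)) ∧
          PSat (η.getD i ∅) (αs i) ∧ Sat (φs i) (η.drop i) := by
      rcases eq_or_ne η [] with rfl | hη
      · exact ⟨fun _ => ψ, fun _ => ψ, rfl, by simp⟩
      · exact ih (hs (by simpa using List.length_pos_iff.mpr hη))
    refine ⟨fun i => i.casesOn φ φs, fun i => i.casesOn α αs, rfl, fun i hi => ?_⟩
    cases i with
    | zero => exact ⟨by simpa [h₀] using hn, hp, h⟩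
    | succ i => simpa using hr i (by simpa using hi)

/-- `η ⊨ φ` iff there is a run `φ = φ₀ →α₀ φ₁ →α₁ … →αₙ φₙ₊₁` of `T_φ`
on `η` such that for every `0 ≤ i ≤ n` both `ω_i ⊨ α_i` and `η_i ⊨ φ_i` hold. -/
theorem stmt3 {P : Type} (φ : LTLf P) (η : List (State P)) (hη : η ≠ []) :
    Sat φ η ↔ ∃ (φs αs : ℕ → LTLf P), φs 0 = φ ∧
      ∀ i < η.length, NFmem (φs i) (αs i) (φs (i + 1)) ∧
        PSat (η.getD i ∅) (αs i) ∧ Sat (φs i) (η.drop i) := by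
  refine ⟨Sat.exists_run, ?_⟩
  rintro ⟨φs, αs, rfl, hr⟩
  exact (hr 0 (List.length_pos_iff.mpr hη)).2.2

end LTLfPaper
end

section
/- Let φ be an Xw-free LTLf formula and η = ω0 a finite trace of length 1. If η ⊨ φ under the finite-trace semantics, then the infinite trace ω0^ω = ω0ω0ω0… satisfies φ read as an LTL formula over infinite traces. -/
namespace LTLfPaper

/-- If the Xw-free formula `φ` holds on the length-1 trace `ω₀`, then
the infinite trace `ω₀^ω` satisfies `φ` read as an LTL formula. -/
theorem stmt6 {P : Type} (φ : LTLf P) (hfree : XwFree φ) (ω₀ : State P)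
    (h : Sat φ [ω₀]) :
    SatInf φ (fun _ => ω₀) := by
  induction φ with
  | tt => trivial
  | ff => exact h
  | pos p => simpa [Sat, SatInf] using h
  | neg p => simpa [Sat, SatInf] using h
  | and φ ψ ihφ ihψ => exact ⟨ihφ hfree.1 h.1, ihψ hfree.2 h.2⟩
  | or φ ψ ihφ ihψ => exact h.imp (ihφ hfree.1) (ihψ hfree.2)
  | next φ _ => exact absurd h.1 (by simp)
  | wnext φ _ => exact hfree.elim
  | untl φ ψ _ ihψ =>
    obtain ⟨i, hi, hψ, -⟩ := h
    obtain rfl : i = 0 := by simpa using hi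
    exact ⟨0, ihψ hfree.2 hψ, fun j hj => absurd hj (Nat.not_lt_zero j)⟩
  | rel φ ψ _ ihψ =>
    have hψ : Sat ψ [ω₀] := by
      rcases h with h | ⟨i, -, -, h⟩
      · exact h 0 (by simp)
      · exact h 0 (Nat.zero_le i)
    exact Or.inl fun _ => ihψ hfree.2 hψ

end LTLfPaper
end

section
/- Let φ be an Xw-free LTLf formula. If φ is satisfiable as an LTLf formula (some finite trace satisfies it), then φ, read as an LTL formula, is LTL-satisfiable (some infinite trace satisfies it). Moreover, if the finite trace ω0…ωn satisfies φ, then the infinite trace ω0…ω_{n-1}(ωn)^ω satisfies φ as an LTL formula. -/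
namespace LTLfPaper

/-- The infinite trace obtained from a finite one by repeating its last state forever. -/
def stutter {P : Type} (η : List (State P)) (hη : η ≠ []) : ℕ → State P :=
  fun i => η.getD i (η.getLast hη)

/-- Shifting a stuttered trace by `i` is stuttering the suffix that starts at position `i`,
or at the last position if `i` lies beyond the end. -/
theorem exists_drop_stutter {P : Type} (η : List (State P)) (hη : η ≠ []) (i : ℕ) :
    ∃ h : η.drop (min i (η.length - 1)) ≠ [],
      (fun n => stutter η hη (n + i)) = stutter (η.drop (min i (η.length - 1))) h := by
  have hpos : 0 < η.length := List.length_pos_iff.mpr hη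
  refine ⟨by rw [Ne, List.drop_eq_nil_iff]; omega, ?_⟩
  funext n
  simp only [stutter, List.getD_eq_getElem?_getD, List.getElem?_drop, List.getLast_drop]
  rcases Nat.lt_or_ge i η.length with hi | hi
  · simp only [Nat.min_eq_left (by omega : i ≤ η.length - 1), Nat.add_comm]
  · simp only [Nat.min_eq_right (by omega : η.length - 1 ≤ i),
      List.getElem?_eq_none (by omega : η.length ≤ n + i)]
    rcases Nat.eq_zero_or_pos n with rfl | hn
    · simp [List.getLast_eq_getElem, hpos]
    · rw [List.getElem?_eq_none (by omega)]

/-- A property of the suffix at a position of a finite trace transfers to the corresponding shift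
of the stuttered trace. -/
theorem shift_stutter_of_drop {P : Type} {φ : LTLf P}
    (ih : ∀ (η : List (State P)) (hη : η ≠ []), Sat φ η → SatInf φ (stutter η hη))
    (η : List (State P)) (hη : η ≠ []) (i : ℕ) (h : Sat φ (η.drop (min i (η.length - 1)))) :
    SatInf φ (fun n => stutter η hη (n + i)) := by
  obtain ⟨hne, heq⟩ := exists_drop_stutter η hη i
  rw [heq]
  exact ih _ hne h

theorem satInf_stutter {P : Type} (φ : LTLf P) (hfree : XwFree φ) :
    ∀ (η : List (State P)) (hη : η ≠ []), Sat φ η → SatInf φ (stutter η hη) := by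
  have key : ∀ {ψ : LTLf P},
      (∀ (η : List (State P)) (hη : η ≠ []), Sat ψ η → SatInf ψ (stutter η hη)) →
      ∀ (η : List (State P)) (hη : η ≠ []) (i : ℕ), i < η.length → Sat ψ (η.drop i) →
        SatInf ψ (fun n => stutter η hη (n + i)) := by
    intro ψ ih η hη i hi h
    refine shift_stutter_of_drop ih η hη i ?_
    rwa [Nat.min_eq_left (by omega)]
  induction φ with
  | tt => exact fun _ _ _ => trivial
  | ff => exact fun _ _ h => h
  | pos p | neg p =>
    intro η hη h
    cases η with
    | nil => exact absurd rfl hη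
    | cons a l => exact h
  | and φ ψ ihφ ihψ =>
    exact fun η hη h => ⟨ihφ hfree.1 η hη h.1, ihψ hfree.2 η hη h.2⟩
  | or φ ψ ihφ ihψ =>
    exact fun η hη h => h.imp (ihφ hfree.1 η hη) (ihψ hfree.2 η hη)
  | next φ ih =>
    intro η hη h
    exact key (ih hfree) η hη 1 h.1 (by simpa using h.2)
  | wnext φ ih => exact hfree.elim
  | untl φ ψ ihφ ihψ =>
    rintro η hη ⟨i, hi, hψ, hφ⟩
    exact ⟨i, key (ihψ hfree.2) η hη i hi hψ,
      fun j hj => key (ihφ hfree.1) η hη j (hj.trans hi) (hφ j hj)⟩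
  | rel φ ψ ihφ ihψ =>
    rintro η hη (h | ⟨i, hi, hφ, hψ⟩)
    · have hpos : 0 < η.length := List.length_pos_iff.mpr hη
      exact Or.inl fun i =>
        shift_stutter_of_drop (ihψ hfree.2) η hη i (h _ (by omega))
    · exact Or.inr ⟨i, key (ihφ hfree.1) η hη i hi hφ,
        fun j hj => key (ihψ hfree.2) η hη j (hj.trans_lt hi) (hψ j hj)⟩

/-- For Xw-free `φ`: if the finite trace `ω₀…ωₙ` satisfies `φ`, then the
infinite trace `ω₀…ω_{n-1}(ωₙ)^ω` satisfies `φ` read as an LTL formula; in particular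
LTLf-satisfiability of `φ` implies its LTL-satisfiability. -/
theorem stmt7 {P : Type} (φ : LTLf P) (hfree : XwFree φ) :
    (∀ (η : List (State P)) (hη : η ≠ []), Sat φ η →
      SatInf φ (fun i => η.getD i (η.getLast hη))) ∧
    ((∃ η : List (State P), η ≠ [] ∧ Sat φ η) → ∃ ξ : ℕ → State P, SatInf φ ξ) :=
  ⟨satInf_stutter φ hfree, fun ⟨η, hη, h⟩ => ⟨stutter η hη, satInf_stutter φ hfree η hη h⟩⟩

end LTLfPaper
end

section
/- Let φ be an LTLf formula. If the propositional formula off(φ) is satisfiable (i.e., ω ⊨ off(φ) for some ω ∈ Σ), then φ is satisfiable as an LTLf formula (some finite trace satisfies φ). -/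
namespace LTLfPaper

theorem sat_replicate_of_psat_ofr {P : Type} {ω : State P} (φ : LTLf P)
    (h : PSat ω (ofr φ)) {n : ℕ} (hn : 0 < n) : Sat φ (List.replicate n ω) := by
  induction φ generalizing n with
  | tt => trivial
  | ff => exact h
  | pos p | neg p => simpa [Sat, hn, ofr, PSat] using h
  | and φ ψ ihφ ihψ => exact ⟨ihφ h.1 hn, ihψ h.2 hn⟩
  | or φ ψ ihφ ihψ => exact h.imp (ihφ · hn) (ihψ · hn)
  | next φ _ | wnext φ _ => exact h.elim
  | untl φ ψ _ ihψ => exact ⟨0, by simpa using hn, by simpa using ihψ h hn, by simp⟩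
  | rel φ ψ _ ihψ =>
    refine Or.inl fun i hi => ?_
    rw [List.length_replicate] at hi
    rw [List.drop_replicate]
    exact ihψ h (Nat.sub_pos_of_lt hi)

theorem exists_forall_sat_replicate_of_psat_off {P : Type} {ω : State P} (φ : LTLf P)
    (h : PSat ω (off φ)) : ∃ N, ∀ n > N, Sat φ (List.replicate n ω) := by
  induction φ with
  | tt => exact ⟨0, fun _ _ => trivial⟩
  | ff => exact h.elim
  | pos p | neg p => exact ⟨0, fun _ hn => sat_replicate_of_psat_ofr _ h hn⟩
  | and φ ψ ihφ ihψ =>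
    obtain ⟨M, hM⟩ := ihφ h.1
    obtain ⟨N, hN⟩ := ihψ h.2
    exact ⟨max M N, fun n hn => ⟨hM n (by omega), hN n (by omega)⟩⟩
  | or φ ψ ihφ ihψ =>
    rcases h with h | h
    · exact (ihφ h).imp fun N hN n hn => Or.inl (hN n hn)
    · exact (ihψ h).imp fun N hN n hn => Or.inr (hN n hn)
  | next φ ih =>
    obtain ⟨N, hN⟩ := ih h
    refine ⟨N + 1, fun n hn => ⟨by rw [List.length_replicate]; omega, ?_⟩⟩
    rw [List.tail_replicate]
    exact hN _ (by omega)
  | wnext φ ih =>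
    obtain ⟨N, hN⟩ := ih h
    refine ⟨N + 1, fun n hn => Or.inr ⟨by rw [List.length_replicate]; omega, ?_⟩⟩
    rw [List.tail_replicate]
    exact hN _ (by omega)
  | untl φ ψ _ ihψ =>
    obtain ⟨N, hN⟩ := ihψ h
    exact ⟨N, fun n hn => ⟨0, by rw [List.length_replicate]; omega, by simpa using hN n hn,
      by simp⟩⟩
  | rel φ ψ _ _ => exact ⟨0, fun _ hn => sat_replicate_of_psat_ofr (.rel φ ψ) h hn⟩

/-- If the propositional formula `off(φ)` is satisfiable, then `φ` is
satisfiable as an LTLf formula. -/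
theorem stmt8 {P : Type} (φ : LTLf P) (h : ∃ ω : State P, PSat ω (off φ)) :
    ∃ η : List (State P), η ≠ [] ∧ Sat φ η := by
  obtain ⟨ω, h⟩ := h
  obtain ⟨N, hN⟩ := exists_forall_sat_replicate_of_psat_off φ h
  exact ⟨List.replicate (N + 1) ω, by simp, hN _ N.lt_succ_self⟩

end LTLfPaper
end

section
/- Let ψ be an LTLf formula and A ∈ Σ with A ⊨ ofr(ψ) (propositional satisfaction). Then the length-1 finite trace consisting of the single state A satisfies ψ. -/
namespace LTLfPaper

/-- If `A ⊨ ofr(ψ)` propositionally, then the length-1 trace `A`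
satisfies `ψ`. -/
theorem stmt10 {P : Type} (ψ : LTLf P) (A : State P) (h : PSat A (ofr ψ)) :
    Sat ψ [A] := by
  induction ψ with
  | tt => simp [Sat]
  | ff => exact h
  | pos p => exact h
  | neg p => exact h
  | and φ ψ ihφ ihψ => exact ⟨ihφ h.1, ihψ h.2⟩
  | or φ ψ ihφ ihψ => exact h.imp ihφ ihψ
  | next φ _ => exact h.elim
  | wnext φ _ => exact h.elim
  | untl φ ψ _ ihψ => exact ⟨0, by simp, ihψ h, by simp⟩
  | rel φ ψ _ ihψ =>
    refine Or.inl fun i hi => ?_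
    obtain rfl : i = 0 := by simpa using hi
    exact ihψ h

end LTLfPaper
end

section
/- Let ψ be an LTLf formula and let φ = G ψ (i.e., ff R ψ) be the corresponding global formula. Then φ is satisfiable as an LTLf formula iff the propositional formula ofg(ψ) is satisfiable (i.e., ω ⊨ ofg(ψ) for some ω ∈ Σ). -/
namespace LTLfPaper

/-- On a one-state trace, a formula holds iff its global obligation formula does. -/
theorem sat_singleton_iff {P : Type} (ω : State P) (φ : LTLf P) :
    Sat φ [ω] ↔ PSat ω (ofg φ) := by
  induction φ with
  | tt | ff | pos | neg | next | wnext => simp [Sat, PSat, ofg]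
  | and φ ψ hφ hψ | or φ ψ hφ hψ => simp [Sat, PSat, ofg, hφ, hψ]
  | untl φ ψ _ hψ => simp [Sat, ofg, hψ]
  | rel φ ψ _ hψ =>
    simp only [Sat, ofg, List.length_singleton, Nat.lt_one_iff, exists_eq_left, forall_eq,
      List.drop_zero, Nat.le_zero, hψ]
    tauto

/-- The global formula `G ψ = ff R ψ` is satisfiable as an LTLf
formula iff the propositional formula `ofg(ψ)` is satisfiable. -/
theorem stmt11 {P : Type} (ψ : LTLf P) :
    (∃ η : List (State P), η ≠ [] ∧ Sat (LTLf.rel LTLf.ff ψ) η) ↔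
    ∃ ω : State P, PSat ω (ofg ψ) := by
  constructor
  · rintro ⟨η, hne, hall | ⟨_, _, hff, _⟩⟩
    · have h := hall (η.length - 1) (Nat.sub_lt (List.length_pos_of_ne_nil hne) one_pos)
      rw [List.drop_length_sub_one hne] at h
      exact ⟨_, (sat_singleton_iff _ _).1 h⟩
    · exact hff.elim
  · rintro ⟨ω, hω⟩
    refine ⟨[ω], List.cons_ne_nil _ _, Or.inl fun i hi => ?_⟩
    obtain rfl : i = 0 := Nat.lt_one_iff.1 hi
    exact (sat_singleton_iff _ _).2 hω

end LTLfPaper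
end

section
/- Let ψ be an LTLf formula, let φ = G ψ (= ff R ψ), and let ψ1 be any state of the transition system T_φ reachable from the initial state φ by a finite sequence of transitions. Then CF(φ) ⊆ CF(ψ1); since CF(φ) = {φ}, equivalently φ ∈ CF(ψ1), i.e., either ψ1 = φ or φ is one of the conjuncts of ψ1. -/
namespace LTLfPaper

theorem not_nfMem_ff {P : Type} {α χ : LTLf P} : ¬ NFmem .ff α χ := nofun

/-- Every successor of `G ψ` has `G ψ` as a conjunct. -/
theorem NFmem.globally_mem_CF {P : Type} {ψ α χ : LTLf P}
    (h : NFmem (.rel .ff ψ) α χ) : LTLf.rel .ff ψ ∈ CF χ := by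
  cases h with
  | rel₁ h => cases h with
    | and' h₁ _ => exact absurd h₁ not_nfMem_ff
  | rel₂ h => cases h with
    | and' _ h₂ => cases h₂ with
      | next h =>
        obtain rfl : _ = LTLf.rel .ff ψ := h
        exact Or.inr rfl

/-- Transitions preserve the presence of the conjunct `G ψ`. -/
theorem Step.globally_mem_CF {P : Type} {ψ χ₁ χ₂ : LTLf P} (h : Step χ₁ χ₂)
    (hχ : LTLf.rel .ff ψ ∈ CF χ₁) : LTLf.rel .ff ψ ∈ CF χ₂ := by
  obtain ⟨α, h⟩ := h
  induction χ₁ generalizing α χ₂ with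
  | and φ₁ φ₂ ih₁ ih₂ =>
    cases h with
    | and' h₁ h₂ => exact hχ.imp (ih₁ · _ h₁) (ih₂ · _ h₂)
  | rel φ₁ φ₂ =>
    cases (hχ : LTLf.rel .ff ψ = .rel φ₁ φ₂)
    exact h.globally_mem_CF
  | _ => cases hχ

/-- For `φ = G ψ = ff R ψ` and any state `ψ₁` of `T_φ` reachable from
the initial state `φ`, we have `CF(φ) ⊆ CF(ψ₁)`; since `CF(φ) = {φ}`, equivalently
`φ ∈ CF(ψ₁)`. -/
theorem stmt12 {P : Type} (ψ ψ₁ : LTLf P)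
    (h : Reachable (LTLf.rel LTLf.ff ψ) ψ₁) :
    CF (LTLf.rel LTLf.ff ψ) ⊆ CF ψ₁ ∧ LTLf.rel LTLf.ff ψ ∈ CF ψ₁ := by
  have hmem : LTLf.rel LTLf.ff ψ ∈ CF ψ₁ := by
    induction h with
    | refl => exact rfl
    | tail _ hstep ih => exact hstep.globally_mem_CF ih
  exact ⟨Set.singleton_subset_iff.mpr hmem, hmem⟩

end LTLfPaper
end

section
/- Let ψ be an LTLf formula and η = ω0 a finite trace of length 1. If η ⊨ ψ, then ω0 ⊨ ofg(ψ) (propositional satisfaction). -/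
namespace LTLfPaper

/-- If the length-1 trace `ω₀` satisfies `ψ`, then `ω₀ ⊨ ofg(ψ)`
propositionally. -/
theorem stmt13 {P : Type} (ψ : LTLf P) (ω₀ : State P) (h : Sat ψ [ω₀]) :
    PSat ω₀ (ofg ψ) := by
  induction ψ with
  | tt => trivial
  | ff => exact h
  | pos p => exact h
  | neg p => exact h
  | and φ ψ ihφ ihψ => exact ⟨ihφ h.1, ihψ h.2⟩
  | or φ ψ ihφ ihψ => exact h.imp ihφ ihψ
  | next φ _ => exact absurd h.1 (lt_irrefl 1)
  | wnext φ _ => trivial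
  | untl φ ψ _ ihψ =>
    obtain ⟨i, hi, hψ, -⟩ := h
    obtain rfl : i = 0 := Nat.lt_one_iff.mp hi
    exact ihψ hψ
  | rel φ ψ _ ihψ =>
    rcases h with h | ⟨i, -, -, h⟩
    · exact ihψ (h 0 Nat.zero_lt_one)
    · exact ihψ (h 0 i.zero_le)

end LTLfPaper
end

section
/- Let ψ be an LTLf formula and A ∈ Σ with A ⊨ ofg(ψ) (propositional satisfaction). Then the length-1 finite trace consisting of the single state A satisfies G ψ (= ff R ψ). -/
namespace LTLfPaper

/-- A state satisfying `ofg ψ` satisfies `ψ` as a trace of length one. -/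
theorem sat_singleton_of_pSat_ofg {P : Type} {A : State P} {ψ : LTLf P}
    (h : PSat A (ofg ψ)) : Sat ψ [A] := by
  induction ψ with
  | tt => trivial
  | ff => exact h
  | pos p => exact h
  | neg p => exact h
  | and φ ψ ihφ ihψ => exact ⟨ihφ h.1, ihψ h.2⟩
  | or φ ψ ihφ ihψ => exact Or.imp ihφ ihψ h
  | next φ _ => exact h.elim
  | wnext φ _ => exact Or.inl rfl
  | untl φ ψ _ ih => exact ⟨0, Nat.one_pos, ih h, fun j hj => absurd hj j.not_lt_zero⟩
  | rel φ ψ _ ih =>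
    refine Or.inl fun i hi => ?_
    obtain rfl : i = 0 := Nat.lt_one_iff.mp hi
    exact ih h

/-- If `A ⊨ ofg(ψ)` propositionally, then the length-1 trace `A`
satisfies `G ψ = ff R ψ`. -/
theorem stmt14 {P : Type} (ψ : LTLf P) (A : State P) (h : PSat A (ofg ψ)) :
    Sat (LTLf.rel LTLf.ff ψ) [A] := by
  refine Or.inl fun i hi => ?_
  obtain rfl : i = 0 := Nat.lt_one_iff.mp hi
  exact sat_singleton_of_pSat_ofg h

end LTLfPaper
end

section
/- Let φ be a formula in the full LTL syntax over a set 𝒫 of atoms and let Tail ∉ 𝒫 be a fresh atom. Define the translation t by: t(p) = p for atoms p; t(¬ψ) = ¬t(ψ); t(ψ1∧ψ2) = t(ψ1) ∧ t(ψ2); t(ψ1∨ψ2) = t(ψ1) ∨ t(ψ2); t(X ψ) = X(Tail ∧ t(ψ)); t(ψ1 U ψ2) = t(ψ1) U (Tail ∧ t(ψ2)). Then φ is satisfiable over finite traces (LTLf semantics) iff the LTL formula Tail ∧ (Tail U G(¬Tail)) ∧ t(φ) is satisfiable over infinite traces (LTL semantics). -/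
namespace FullLTL

/-- Formulas in the full LTL syntax over atoms `P`. -/
inductive LTL (P : Type) : Type
  | atom (p : P)
  | not (φ : LTL P)
  | and (φ ψ : LTL P)
  | or (φ ψ : LTL P)
  | next (φ : LTL P)
  | untl (φ ψ : LTL P)

/-- Finite-trace (LTLf) satisfaction over nonempty words over `2^P`;
the suffix `η_i` is `η.drop i` and the first state is `η.getD 0 ∅`. -/
def FinSat {P : Type} : LTL P → List (Set P) → Prop
  | .atom p, η => p ∈ η.getD 0 ∅
  | .not φ, η => ¬ FinSat φ η
  | .and φ ψ, η => FinSat φ η ∧ FinSat ψ η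
  | .or φ ψ, η => FinSat φ η ∨ FinSat ψ η
  | .next φ, η => 1 < η.length ∧ FinSat φ η.tail
  | .untl φ ψ, η => ∃ i < η.length, FinSat ψ (η.drop i) ∧ ∀ j < i, FinSat φ (η.drop j)

/-- Infinite-trace (standard LTL) satisfaction. -/
def InfSat {P : Type} : LTL P → (ℕ → Set P) → Prop
  | .atom p, ξ => p ∈ ξ 0
  | .not φ, ξ => ¬ InfSat φ ξ
  | .and φ ψ, ξ => InfSat φ ξ ∧ InfSat ψ ξ
  | .or φ ψ, ξ => InfSat φ ξ ∨ InfSat ψ ξ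
  | .next φ, ξ => InfSat φ (fun n => ξ (n + 1))
  | .untl φ ψ, ξ =>
      ∃ i, InfSat ψ (fun n => ξ (n + i)) ∧ ∀ j < i, InfSat φ (fun n => ξ (n + j))

/-- The fresh atom `Tail`; atoms of `P` are embedded via `some`, `Tail = none ∉ P`. -/
def Tail {P : Type} : LTL (Option P) := .atom none

/-- `tt` (here `Tail ∨ ¬Tail`). -/
def ttO {P : Type} : LTL (Option P) := .or Tail (.not Tail)

/-- `G ψ` abbreviates `¬(tt U ¬ψ)`. -/
def Gf {P : Type} (ψ : LTL (Option P)) : LTL (Option P) := .not (.untl ttO (.not ψ))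

/-- The translation `t` from LTLf over `P` to LTL over `P ∪ {Tail}`. -/
def t {P : Type} : LTL P → LTL (Option P)
  | .atom p => .atom (some p)
  | .not φ => .not (t φ)
  | .and φ ψ => .and (t φ) (t ψ)
  | .or φ ψ => .or (t φ) (t ψ)
  | .next φ => .next (.and Tail (t φ))
  | .untl φ ψ => .untl (t φ) (.and Tail (t ψ))

/-- The infinite trace `ξ` encodes the finite trace `η`: `Tail` holds exactly at the positions
of `η`, where the two traces agree on the atoms of `P`. -/
def Encodes {P : Type} (η : List (Set P)) (ξ : ℕ → Set (Option P)) : Prop :=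
  (∀ n, none ∈ ξ n ↔ n < η.length) ∧
    ∀ n < η.length, ∀ p, some p ∈ ξ n ↔ p ∈ η.getD n ∅

theorem Encodes.drop {P : Type} {η : List (Set P)} {ξ : ℕ → Set (Option P)}
    (h : Encodes η ξ) (i : ℕ) : Encodes (η.drop i) (fun n => ξ (n + i)) := by
  refine ⟨fun n => ?_, fun n hn p => ?_⟩
  · rw [h.1, List.length_drop]
    omega
  · rw [List.length_drop] at hn
    rw [h.2 _ (by omega)]
    simp [List.getD_eq_getElem?_getD, Nat.add_comm]

theorem Encodes.finSat_iff {P : Type} (φ : LTL P) {η : List (Set P)} {ξ : ℕ → Set (Option P)}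
    (hη : 0 < η.length) (h : Encodes η ξ) : FinSat φ η ↔ InfSat (t φ) ξ := by
  induction φ generalizing η ξ with
  | atom p => simpa [FinSat, t, InfSat] using (h.2 0 hη p).symm
  | not φ ih => simp only [FinSat, t, InfSat, ih hη h]
  | and φ ψ ih₁ ih₂ => simp only [FinSat, t, InfSat, ih₁ hη h, ih₂ hη h]
  | or φ ψ ih₁ ih₂ => simp only [FinSat, t, InfSat, ih₁ hη h, ih₂ hη h]
  | next φ ih =>
    simp only [FinSat, t, InfSat, Tail, h.1]
    rw [Nat.zero_add]
    refine and_congr_right fun hlen => ?_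
    rw [← List.drop_one]
    exact ih (by rw [List.length_drop]; omega) (h.drop 1)
  | untl φ ψ ih₁ ih₂ =>
    simp only [FinSat, t, InfSat, Tail, h.1]
    refine exists_congr fun i => ?_
    rw [Nat.zero_add, and_assoc]
    refine and_congr_right fun hi => and_congr ?_ (forall₂_congr fun j hj => ?_)
    · exact ih₂ (by rw [List.length_drop]; omega) (h.drop i)
    · exact ih₁ (by rw [List.length_drop]; omega) (h.drop j)

theorem infSat_Gf_not_Tail {P : Type} (ξ : ℕ → Set (Option P)) :
    InfSat (Gf (LTL.not Tail)) ξ ↔ ∀ n, none ∉ ξ n := by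
  simp [Gf, InfSat, ttO, Tail, em]

/-- `φ` is satisfiable over finite traces iff the LTL formula
`Tail ∧ (Tail U G(¬Tail)) ∧ t(φ)` is satisfiable over infinite traces. -/
theorem stmt15 {P : Type} (φ : LTL P) :
    (∃ η : List (Set P), η ≠ [] ∧ FinSat φ η) ↔
    (∃ ξ : ℕ → Set (Option P),
      InfSat (LTL.and Tail (LTL.and (LTL.untl Tail (Gf (LTL.not Tail))) (t φ))) ξ) := by
  constructor
  · rintro ⟨η, hne, hφ⟩
    have hη : 0 < η.length := List.length_pos_iff.2 hne
    obtain ⟨ξ, h⟩ : ∃ ξ, Encodes η ξ :=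
      ⟨fun n => {o | n < η.length ∧ ∀ p, o = some p → p ∈ η.getD n ∅}, fun n => by simp,
        fun n hn p => by simp [hn]⟩
    refine ⟨ξ, (h.1 0).2 hη, ⟨η.length, ?_, fun j hj => ?_⟩, (h.finSat_iff φ hη).1 hφ⟩
    · rw [infSat_Gf_not_Tail]
      intro n hn
      have := (h.1 _).1 hn
      omega
    · exact (h.1 _).2 (by omega)
  · rintro ⟨ξ, h0, ⟨k, hk, hlt⟩, hφ⟩
    rw [infSat_Gf_not_Tail] at hk
    have hnone : ∀ n, none ∈ ξ n ↔ n < k := by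
      refine fun n => ⟨fun hn => ?_, fun hn => ?_⟩
      · by_contra hkn
        exact hk (n - k) (by rwa [Nat.sub_add_cancel (by omega)])
      · simpa [InfSat, Tail] using hlt n hn
    have hpos : 0 < k := (hnone 0).1 h0
    have h : Encodes (List.ofFn fun i : Fin k => {p | some p ∈ ξ i}) ξ := by
      refine ⟨fun n => by simpa using hnone n, fun n hn p => ?_⟩
      rw [List.getD_eq_getElem _ _ hn]
      simp
    have hlen : 0 < (List.ofFn fun i : Fin k => {p | some p ∈ ξ i}).length := by simpa using hpos
    exact ⟨_, List.length_pos_iff.1 hlen, (h.finSat_iff φ hlen).2 hφ⟩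

end FullLTL
end
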